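/- Let a, y > 0. Then the limit ψ^P(a,y) := lim_{n→∞} (1/n) log C_n(a,y) exists and equals max{λ^P(y), κ^P(a)}, where λ^P(y) = log 2 for y ≤ 1 and λ^P(y) = log(y²+1) − log y for y > 1, and κ^P(a) = log 2 for a ≤ 2 and κ^P(a) = log a − (1/2) log(a−1) for a > 2. -/

import Mathlib

open Finset Filter

attribute [local instance] Classical.propDecidable

/-- Height (second coordinate) of a binomial path after `i` steps, starting at height `c`;
steps are encoded by `s : Fin n → Bool` (`true` = up step `(1,1)`, `false` = down step `(1,-1)`).
The path visits the points `(x₀ + i, hgt c s i)` for `0 ≤ i ≤ n`. -/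
def hgt {n : ℕ} (c : ℤ) (s : Fin n → Bool) (i : ℕ) : ℤ :=
  c + ∑ j ∈ Finset.range i, (if h : j < n then (if s ⟨j, h⟩ then (1 : ℤ) else -1) else 0)

/-- The path lies in the upper half-plane (all second coordinates ≥ 0). -/
def InUHP {n : ℕ} (c : ℤ) (s : Fin n → Bool) : Prop :=
  ∀ i ≤ n, 0 ≤ hgt c s i

/-- The number of vertices of the path with second coordinate 0. -/
def visits {n : ℕ} (c : ℤ) (s : Fin n → Bool) : ℕ :=
  ((Finset.range (n + 1)).filter (fun i => hgt c s i = 0)).card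

/-- `C_n(a,y) = Σ_{v,h} c_n(v,h) a^v y^h`: partition function of upper half-plane
binomial paths of length `n` starting at `(0,0)`, with weight `a` per vertex with second
coordinate `0` and weight `y` per unit height of the final vertex. -/
noncomputable def Cpf (n : ℕ) (a y : ℝ) : ℝ :=
  ∑ s ∈ (Finset.univ : Finset (Fin n → Bool)).filter (fun s => InUHP 0 s),
    a ^ visits 0 s * y ^ hgt 0 s n

/-- Partition function of paths starting at height `c`. -/
noncomputable def Wpf (a y : ℝ) (n : ℕ) (c : ℤ) : ℝ :=
  ∑ s : Fin n → Bool, if InUHP c s then a ^ visits c s * y ^ hgt c s n else 0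

lemma Cpf_eq_Wpf (n : ℕ) (a y : ℝ) : Cpf n a y = Wpf a y n 0 := by
  unfold Cpf Wpf
  rw [Finset.sum_filter]

lemma hgt_zero {n : ℕ} (c : ℤ) (s : Fin n → Bool) : hgt c s 0 = c := by
  simp [hgt]

lemma hgt_cons {n : ℕ} (c : ℤ) (b : Bool) (s : Fin n → Bool) (i : ℕ) :
    hgt c (Fin.cons b s : Fin (n + 1) → Bool) (i + 1)
      = hgt (c + if b then 1 else -1) s i := by
  unfold hgt
  rw [Finset.sum_range_succ']
  have h0 : (if h : 0 < n + 1 then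
      (if (Fin.cons b s : Fin (n + 1) → Bool) ⟨0, h⟩ then (1 : ℤ) else -1) else 0)
      = if b then 1 else -1 := by
    rw [dif_pos (Nat.succ_pos n)]
    rfl
  rw [h0]
  have h1 : ∀ j ∈ Finset.range i, (if h : j + 1 < n + 1 then
      (if (Fin.cons b s : Fin (n + 1) → Bool) ⟨j + 1, h⟩ then (1 : ℤ) else -1) else 0)
      = (if h : j < n then (if s ⟨j, h⟩ then (1 : ℤ) else -1) else 0) := by
    intro j _
    by_cases hj : j < n
    · rw [dif_pos hj, dif_pos (Nat.succ_lt_succ hj)]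
      rfl
    · rw [dif_neg hj, dif_neg (by omega)]
  rw [Finset.sum_congr rfl h1]
  ring

lemma inUHP_cons {n : ℕ} (c : ℤ) (b : Bool) (s : Fin n → Bool) :
    InUHP c (Fin.cons b s : Fin (n + 1) → Bool)
      ↔ 0 ≤ c ∧ InUHP (c + if b then 1 else -1) s := by
  unfold InUHP
  constructor
  · intro h
    refine ⟨by simpa [hgt_zero] using h 0 (Nat.zero_le _), fun i hi => ?_⟩
    have := h (i + 1) (by omega)
    rwa [hgt_cons] at this
  · rintro ⟨h0, h⟩ i hi
    cases i with
    | zero => rw [hgt_zero]; exact h0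
    | succ i => rw [hgt_cons]; exact h i (by omega)

lemma visits_cons {n : ℕ} (c : ℤ) (b : Bool) (s : Fin n → Bool) :
    visits c (Fin.cons b s : Fin (n + 1) → Bool)
      = (if c = 0 then 1 else 0) + visits (c + if b then 1 else -1) s := by
  unfold visits
  rw [Finset.card_filter, Finset.card_filter, Finset.sum_range_succ']
  simp only [hgt_cons, hgt_zero]
  rw [add_comm]

/-- Vertex weight. -/
noncomputable def vw (a : ℝ) (c : ℤ) : ℝ := if c = 0 then a else 1

lemma Wpf_neg (a y : ℝ) (n : ℕ) (c : ℤ) (hc : c < 0) : Wpf a y n c = 0 := by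
  unfold Wpf
  refine Finset.sum_eq_zero fun s _ => if_neg fun h => ?_
  have := h 0 (Nat.zero_le _)
  rw [hgt_zero] at this
  omega

lemma Wpf_zero (a y : ℝ) (c : ℤ) (hc : 0 ≤ c) : Wpf a y 0 c = vw a c * y ^ c := by
  unfold Wpf
  rw [Fintype.sum_unique]
  have h : ∀ s : Fin 0 → Bool, InUHP c s := by
    intro s i hi
    obtain rfl : i = 0 := by omega
    rwa [hgt_zero]
  rw [if_pos (h _), hgt_zero]
  congr 1
  unfold visits vw
  rw [Finset.card_filter, Finset.sum_range_one, hgt_zero]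
  split_ifs <;> simp

lemma Wpf_succ (a y : ℝ) (n : ℕ) (c : ℤ) (hc : 0 ≤ c) :
    Wpf a y (n + 1) c = vw a c * (Wpf a y n (c + 1) + Wpf a y n (c - 1)) := by
  have key : ∀ (b : Bool) (s : Fin n → Bool),
      (if InUHP c (Fin.cons b s : Fin (n + 1) → Bool) then
        a ^ visits c (Fin.cons b s : Fin (n + 1) → Bool)
          * y ^ hgt c (Fin.cons b s : Fin (n + 1) → Bool) (n + 1) else 0)
      = vw a c * (if InUHP (c + if b then 1 else -1) s then
          a ^ visits (c + if b then 1 else -1) s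
            * y ^ hgt (c + if b then 1 else -1) s n else 0) := by
    intro b s
    rw [hgt_cons, visits_cons]
    simp only [inUHP_cons, hc, true_and]
    by_cases h : InUHP (c + if b then 1 else -1) s
    · rw [if_pos h, if_pos h, pow_add]
      unfold vw
      split_ifs <;> ring
    · rw [if_neg h, if_neg h, mul_zero]
  unfold Wpf
  rw [← (Fin.consEquiv (fun _ : Fin (n + 1) => Bool)).sum_comp, Fintype.sum_prod_type,
    Fintype.sum_bool]
  have e : ∀ (b : Bool) (s : Fin n → Bool),
      (Fin.consEquiv (fun _ : Fin (n + 1) => Bool)) (b, s) = (Fin.cons b s : Fin (n + 1) → Bool) :=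
    fun _ _ => rfl
  simp only [e, key]
  rw [← Finset.mul_sum, ← Finset.mul_sum, ← mul_add]
  simp [sub_eq_add_neg]

lemma Wpf_rec_zero (a y : ℝ) (n : ℕ) :
    Wpf a y (n + 1) ((0 : ℕ) : ℤ) = a * Wpf a y n ((1 : ℕ) : ℤ) := by
  rw [Wpf_succ _ _ _ _ (by simp), Wpf_neg a y n (((0 : ℕ) : ℤ) - 1) (by simp)]
  simp [vw]

lemma Wpf_rec_succ (a y : ℝ) (n k : ℕ) :
    Wpf a y (n + 1) ((k + 1 : ℕ) : ℤ)
      = Wpf a y n ((k + 2 : ℕ) : ℤ) + Wpf a y n ((k : ℕ) : ℤ) := by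
  rw [Wpf_succ _ _ _ _ (by omega)]
  have h : vw a ((k + 1 : ℕ) : ℤ) = 1 := if_neg (by omega)
  rw [h, one_mul]
  congr 2 <;> push_cast <;> ring

/-- Supersolutions give upper bounds. -/
lemma upper_of_super (a y : ℝ) (ha : 0 < a) (h : ℕ → ℝ) (R : ℝ) (hR : 0 < R)
    (h0 : h 1 ≤ R * h 0) (h1 : h 2 + a * h 0 ≤ R * h 1)
    (h2 : ∀ k, h (k + 3) + h (k + 1) ≤ R * h (k + 2))
    (K : ℝ) (hK : 0 < K) (hy : ∀ k, y ^ k ≤ K * h k) (n : ℕ) :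
    Wpf a y n 0 ≤ (a * K * h 0) * R ^ n := by
  have main : ∀ n : ℕ, ∀ k : ℕ, Wpf a y n (k : ℤ) ≤ vw a k * (K * R ^ n * h k) := by
    intro n
    induction n with
    | zero =>
      intro k
      rw [Wpf_zero _ _ _ (by omega), zpow_natCast]
      have : 0 ≤ vw a k := by unfold vw; split_ifs <;> positivity
      have := mul_le_mul_of_nonneg_left (hy k) this
      simpa using this
    | succ n ih =>
      have e : ∀ k : ℕ, vw a ((k + 1 : ℕ) : ℤ) = 1 := fun k => if_neg (by omega)
      have e0 : vw a ((0 : ℕ) : ℤ) = a := if_pos (by simp)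
      have p : 0 < K * R ^ n := by positivity
      intro k
      rcases k with _ | _ | k
      · rw [Wpf_rec_zero, e0]
        have := ih 1
        rw [e 0, one_mul] at this
        have h3 := mul_le_mul_of_nonneg_left h0 p.le
        refine mul_le_mul_of_nonneg_left ?_ ha.le
        rw [pow_succ]
        linarith
      · rw [Wpf_rec_succ, e 0]
        have i1 := ih 0
        have i2 := ih 2
        rw [e 1] at i2
        rw [e0] at i1
        have h3 := mul_le_mul_of_nonneg_left h1 p.le
        rw [pow_succ]
        simp only [zero_add] at *
        linarith
      · rw [Wpf_rec_succ, e (k + 1)]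
        have i1 := ih (k + 1)
        have i2 := ih (k + 3)
        rw [e k] at i1
        rw [e (k + 2)] at i2
        have h3 := mul_le_mul_of_nonneg_left (h2 k) p.le
        rw [pow_succ]
        have e3 : k + 1 + 2 = k + 3 := rfl
        have e4 : k + 1 + 1 = k + 2 := rfl
        rw [e3, e4]
        linarith
  have := main n 0
  have e0 : vw a ((0 : ℕ) : ℤ) = a := if_pos (by simp)
  rw [e0] at this
  calc Wpf a y n 0 ≤ _ := this
    _ = _ := by ring

/-- Subsolutions give lower bounds. -/
lemma lower_of_sub (a y : ℝ) (ha : 0 < a) (h : ℕ → ℝ) (R : ℝ) (hR : 0 < R)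
    (h0 : R * h 0 ≤ h 1) (h1 : R * h 1 ≤ h 2 + a * h 0)
    (h2 : ∀ k, R * h (k + 2) ≤ h (k + 3) + h (k + 1))
    (K : ℝ) (hK : 0 < K) (hy : ∀ k, K * h k ≤ y ^ k) (n : ℕ) :
    (a * K * h 0) * R ^ n ≤ Wpf a y n 0 := by
  have main : ∀ n : ℕ, ∀ k : ℕ, vw a k * (K * R ^ n * h k) ≤ Wpf a y n (k : ℤ) := by
    intro n
    induction n with
    | zero =>
      intro k
      rw [Wpf_zero _ _ _ (by omega), zpow_natCast]
      have : 0 ≤ vw a k := by unfold vw; split_ifs <;> positivity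
      have := mul_le_mul_of_nonneg_left (hy k) this
      simpa using this
    | succ n ih =>
      have e : ∀ k : ℕ, vw a ((k + 1 : ℕ) : ℤ) = 1 := fun k => if_neg (by omega)
      have e0 : vw a ((0 : ℕ) : ℤ) = a := if_pos (by simp)
      have p : 0 < K * R ^ n := by positivity
      intro k
      rcases k with _ | _ | k
      · rw [Wpf_rec_zero, e0]
        have := ih 1
        rw [e 0, one_mul] at this
        have h3 := mul_le_mul_of_nonneg_left h0 p.le
        refine mul_le_mul_of_nonneg_left ?_ ha.le
        rw [pow_succ]
        linarith
      · rw [Wpf_rec_succ, e 0]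
        have i1 := ih 0
        have i2 := ih 2
        rw [e 1] at i2
        rw [e0] at i1
        have h3 := mul_le_mul_of_nonneg_left h1 p.le
        rw [pow_succ]
        simp only [zero_add] at *
        linarith
      · rw [Wpf_rec_succ, e (k + 1)]
        have i1 := ih (k + 1)
        have i2 := ih (k + 3)
        rw [e k] at i1
        rw [e (k + 2)] at i2
        have h3 := mul_le_mul_of_nonneg_left (h2 k) p.le
        rw [pow_succ]
        have e3 : k + 1 + 2 = k + 3 := rfl
        have e4 : k + 1 + 1 = k + 2 := rfl
        rw [e3, e4]
        linarith
  have := main n 0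
  have e0 : vw a ((0 : ℕ) : ℤ) = a := if_pos (by simp)
  rw [e0] at this
  calc _ = _ := by ring
    _ ≤ Wpf a y n 0 := this

/-- Upper bound with rate `z + 1/z`. -/
lemma upper_z (a y z : ℝ) (ha : 0 < a) (hy : 0 < y) (hz : 0 < z) (hyz : y ≤ z)
    (haz : a < z ^ 2 + 1) :
    ∃ C > 0, ∀ n : ℕ, Wpf a y n 0 ≤ C * (z + z⁻¹) ^ n := by
  obtain ⟨B, hB, hB0⟩ : ∃ B : ℝ, a * (z ^ 2 + B) ≤ (1 + B) * (z ^ 2 + 1) ∧ 0 ≤ B := by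
    refine ⟨a * z ^ 2 / (z ^ 2 + 1 - a), ?_, ?_⟩
    · have hd : 0 < z ^ 2 + 1 - a := by linarith
      have : a * z ^ 2 / (z ^ 2 + 1 - a) * (z ^ 2 + 1 - a) = a * z ^ 2 := by field_simp
      nlinarith [sq_nonneg z]
    · have hd : 0 < z ^ 2 + 1 - a := by linarith
      positivity
  set t : ℝ := (1 + B) / a with ht
  have ht0 : 0 < t := by positivity
  set h : ℕ → ℝ := fun k => if k = 0 then t else z ^ k + B * (z⁻¹) ^ k with hh
  have hs : ∀ k, h (k + 1) = z ^ (k + 1) + B * (z⁻¹) ^ (k + 1) := fun k => by simp [hh]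
  have hz0 : h 0 = t := by simp [hh]
  have hzi : z * z⁻¹ = 1 := by field_simp
  refine ⟨a * (1 + t⁻¹) * h 0, by rw [hz0]; positivity, fun n => ?_⟩
  apply upper_of_super a y ha h (z + z⁻¹) (by positivity)
  · rw [hz0, hs 0, ht]
    simp only [zero_add, pow_one]
    have e1 : z + B * z⁻¹ = (a * (z ^ 2 + B)) / (a * z) := by field_simp
    have e2 : (z + z⁻¹) * ((1 + B) / a) = ((1 + B) * (z ^ 2 + 1)) / (a * z) := by field_simp
    rw [e1, e2]
    gcongr
  · rw [hz0, hs 0, hs 1, ht]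
    have : a * ((1 + B) / a) = 1 + B := by field_simp
    rw [this]
    apply le_of_eq
    simp only [zero_add, pow_one, Nat.reduceAdd]
    linear_combination (-1 - B) * hzi
  · intro k
    rw [hs (k + 2), hs k, hs (k + 1)]
    apply le_of_eq
    simp only [pow_succ]
    linear_combination (-z ^ k * z - B * z⁻¹ ^ k * z⁻¹) * hzi
  · positivity
  · intro k
    rcases k with _ | k
    · rw [hz0, pow_zero]
      have : t⁻¹ * t = 1 := by field_simp
      nlinarith
    · rw [hs k]
      have h1 : y ^ (k + 1) ≤ z ^ (k + 1) := by gcongr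
      have h2 : 0 ≤ B * z⁻¹ ^ (k + 1) := by positivity
      have h3 : 0 < t⁻¹ := by positivity
      have h4 : 0 < z ^ (k + 1) := by positivity
      nlinarith [mul_pos h3 h4, mul_nonneg h3.le h2]

/-- Finitely supported functions are dominated by geometric ones. -/
lemma fin_dom (y : ℝ) (hy : 0 < y) (h : ℕ → ℝ) (N : ℕ) (hN : ∀ k, N ≤ k → h k ≤ 0) :
    ∃ K > 0, ∀ k, K * h k ≤ y ^ k := by
  set S : ℝ := 1 + ∑ k ∈ Finset.range N, |h k| / y ^ k with hS
  have hS0 : 0 < S := by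
    have : 0 ≤ ∑ k ∈ Finset.range N, |h k| / y ^ k :=
      Finset.sum_nonneg fun k _ => by positivity
    linarith
  refine ⟨S⁻¹, by positivity, fun k => ?_⟩
  have hyk : 0 < y ^ k := by positivity
  rw [inv_mul_le_iff₀ hS0]
  by_cases hk : N ≤ k
  · exact (hN k hk).trans (by positivity)
  · have h1 : |h k| / y ^ k ≤ ∑ k ∈ Finset.range N, |h k| / y ^ k :=
      Finset.single_le_sum (f := fun k => |h k| / y ^ k) (fun k _ => by positivity)
        (Finset.mem_range.2 (by omega))
    have h2 : |h k| / y ^ k ≤ S := by linarith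
    rw [div_le_iff₀ hyk] at h2
    exact (le_abs_self _).trans h2

lemma lower_y (a y : ℝ) (ha : 0 < a) (hy : 1 < y) :
    ∃ C > 0, ∀ n : ℕ, C * (y + y⁻¹) ^ n ≤ Wpf a y n 0 := by
  have hy0 : 0 < y := by linarith
  have hyi : y * y⁻¹ = 1 := by field_simp
  have hi : y⁻¹ < 1 := inv_lt_one_of_one_lt₀ hy
  have hi0 : 0 < y⁻¹ := by positivity
  set t : ℝ := (y - y⁻¹) / (y + y⁻¹) with ht
  have ht0 : 0 < t := div_pos (by linarith) (by positivity)
  have ht1 : t ≤ 1 := by rw [ht, div_le_one (by positivity)]; linarith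
  set h : ℕ → ℝ := fun k => if k = 0 then t else y ^ k - (y⁻¹) ^ k with hh
  have hs : ∀ k, h (k + 1) = y ^ (k + 1) - (y⁻¹) ^ (k + 1) := fun k => by simp [hh]
  have hz0 : h 0 = t := by simp [hh]
  refine ⟨a * 1 * h 0, by rw [hz0]; positivity, fun n => ?_⟩
  apply lower_of_sub a y ha h (y + y⁻¹) (by positivity)
  · rw [hz0, hs 0, ht]
    have hne : y + y⁻¹ ≠ 0 := by positivity
    rw [mul_div_cancel₀ _ hne, zero_add, pow_one, pow_one]
  · rw [hz0, hs 0, hs 1]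
    have := mul_pos ha ht0
    simp only [zero_add, pow_one, Nat.reduceAdd]
    nlinarith
  · intro k
    rw [hs (k + 2), hs k, hs (k + 1)]
    apply le_of_eq
    simp only [pow_succ]
    linear_combination (y ^ k * y - y⁻¹ ^ k * y⁻¹) * hyi
  · norm_num
  · intro k
    rcases k with _ | k
    · rw [hz0, pow_zero]; linarith
    · rw [hs k]
      have : 0 < y⁻¹ ^ (k + 1) := by positivity
      linarith

lemma lower_two (a y r : ℝ) (ha : 0 < a) (hy : 0 < y) (hr : 0 < r) (hr2 : r < 2) :
    ∃ C > 0, ∀ n : ℕ, C * r ^ n ≤ Wpf a y n 0 := by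
  obtain ⟨M, hM⟩ := exists_nat_gt (2 / (2 - r))
  have hM' : 2 < (2 - r) * M := by
    rw [div_lt_iff₀ (by linarith)] at hM; linarith
  have hM0 : (0 : ℝ) < M := by
    by_contra hc
    nlinarith
  -- N = M + 1
  set t : ℝ := M / r with ht
  have ht0 : 0 < t := by positivity
  set q : ℕ → ℝ := fun k => (k : ℝ) * (M + 1 - k) with hq
  set h : ℕ → ℝ := fun k => if k = 0 then t else max 0 (q k) with hh
  have hs : ∀ k, h (k + 1) = max 0 (q (k + 1)) := fun k => by simp [hh]
  have hz0 : h 0 = t := by simp [hh]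
  have bulk : ∀ k : ℕ, r * max 0 (q (k + 1)) ≤ max 0 (q (k + 2)) + max 0 (q k) := by
    intro k
    by_cases hk : k < M
    · have hk' : (k : ℝ) + 1 ≤ M := by exact_mod_cast hk
      have hk0 : (0 : ℝ) ≤ k := Nat.cast_nonneg k
      have e1 : (M : ℝ) ≤ q (k + 1) := by simp only [hq]; push_cast; nlinarith
      rw [max_eq_right (by linarith : 0 ≤ q (k + 1))]
      have e2 : q (k + 2) + q k = 2 * q (k + 1) - 2 := by simp only [hq]; push_cast; ring
      have := le_max_right 0 (q (k + 2))
      have := le_max_right 0 (q k)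
      nlinarith
    · have hk' : (M : ℝ) ≤ k := by exact_mod_cast (not_lt.1 hk)
      have e1 : q (k + 1) ≤ 0 := by simp only [hq]; push_cast; nlinarith
      rw [max_eq_left e1, mul_zero]
      positivity
  obtain ⟨K, hK, hKy⟩ := fin_dom y hy h (M + 1) (by
    intro k hk
    rcases k with _ | k
    · omega
    · rw [hs]
      have hk' : (M : ℝ) ≤ k := by exact_mod_cast (by omega : M ≤ k)
      refine max_le le_rfl ?_
      simp only [hq]; push_cast; nlinarith)
  refine ⟨a * K * h 0, by rw [hz0]; positivity, fun n => ?_⟩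
  apply lower_of_sub a y ha h r hr ?_ ?_ ?_ K hK hKy
  · rw [hz0, hs 0, ht]
    have : r * (M / r) = M := by field_simp
    rw [this]
    refine le_trans (le_of_eq ?_) (le_max_right _ _)
    simp [hq]
  · rw [hz0, hs 0, hs 1]
    have := bulk 0
    have e : max 0 (q 0) = 0 := by simp [hq]
    rw [e] at this
    have := mul_pos ha ht0
    simp only [zero_add] at *
    linarith
  · intro k
    rw [hs (k + 2), hs k, hs (k + 1)]
    exact bulk (k + 1)

lemma lower_a (a y s r : ℝ) (hy : 0 < y) (hs1 : 1 < s) (has : a = s ^ 2 + 1)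
    (hr : 2 ≤ r) (hrs : r < s + s⁻¹) :
    ∃ C > 0, ∀ n : ℕ, C * r ^ n ≤ Wpf a y n 0 := by
  have hs0 : 0 < s := by linarith
  have ha : 0 < a := by rw [has]; positivity
  set u : ℝ := s⁻¹ with hu
  have hu0 : 0 < u := by positivity
  have hu1 : u < 1 := inv_lt_one_of_one_lt₀ hs1
  have hsu : s * u = 1 := by rw [hu]; field_simp
  have hau : a * u = s + u := by rw [has]; linear_combination s * hsu
  set d : ℝ := (s + u - r) / a with hd
  have hd0 : 0 < d := div_pos (by linarith) ha
  have had : a * d = s + u - r := by rw [hd]; field_simp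
  set h : ℕ → ℝ := fun k => if k = 0 then 1 / a else max 0 (u ^ k - d) with hh
  have hs : ∀ k, h (k + 1) = max 0 (u ^ (k + 1) - d) := fun k => by simp [hh]
  have hz0 : h 0 = 1 / a := by simp [hh]
  obtain ⟨N, hN⟩ := exists_pow_lt_of_lt_one hd0 hu1
  obtain ⟨K, hK, hKy⟩ := fin_dom y hy h (N + 1) (by
    intro k hk
    rcases k with _ | k
    · omega
    · rw [hs]
      refine max_le le_rfl ?_
      have : u ^ (k + 1) ≤ u ^ N := pow_le_pow_of_le_one hu0.le hu1.le (by omega)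
      linarith)
  refine ⟨a * K * h 0, by rw [hz0]; positivity, fun n => ?_⟩
  have hud : r * (1 / a) = u - d := by
    have : u - d = (a * (u - d)) / a := by field_simp
    rw [this, mul_sub, hau, had]
    ring
  have hud0 : 0 < u - d := by rw [← hud]; positivity
  apply lower_of_sub a y ha h r (by linarith) ?_ ?_ ?_ K hK hKy
  · rw [hz0, hs 0, zero_add, pow_one, hud]
    exact le_max_right _ _
  · rw [hz0, hs 0, hs 1]
    simp only [zero_add, pow_one, Nat.reduceAdd]
    have e : a * (1 / a) = 1 := by field_simp
    rw [e, max_eq_right hud0.le]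
    have := le_max_right 0 (u ^ 2 - d)
    nlinarith
  · intro k
    rw [hs (k + 2), hs k, hs (k + 1)]
    have m1 := le_max_right 0 (u ^ (k + 2 + 1) - d)
    have m2 := le_max_right 0 (u ^ (k + 1) - d)
    have p1 := le_max_left 0 (u ^ (k + 2 + 1) - d)
    have p2 := le_max_left 0 (u ^ (k + 1) - d)
    rcases le_total 0 (u ^ (k + 1 + 1) - d) with hc | hc
    · rw [max_eq_right hc]
      have e : u ^ (k + 2 + 1) + u ^ (k + 1) = (s + u) * u ^ (k + 1 + 1) := by
        simp only [pow_succ]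
        linear_combination (-u ^ k * u) * hsu
      have pk : 0 < u ^ (k + 1 + 1) := by positivity
      nlinarith
    · rw [max_eq_left hc]
      linarith

/-- Exponential bounds give the limit. -/
lemma tendsto_of_bounds (f : ℕ → ℝ) (ρ : ℝ) (hρ : 0 < ρ)
    (hl : ∀ r, 0 < r → r < ρ → ∃ C > 0, ∀ n, C * r ^ n ≤ f n)
    (hu : ∀ r, ρ < r → ∃ C > 0, ∀ n, f n ≤ C * r ^ n) :
    Tendsto (fun n : ℕ => Real.log (f n) / n) atTop (nhds (Real.log ρ)) := by
  have aux : ∀ C r : ℝ, Tendsto (fun n : ℕ => C / (n : ℝ) + r) atTop (nhds r) := by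
    intro C r
    have := (tendsto_const_div_atTop_nhds_zero_nat C).add_const r
    simpa using this
  have ex : ∀ C r : ℝ, 0 < C → 0 < r → ∀ n : ℕ, 0 < n →
      Real.log (C * r ^ n) / n = Real.log C / n + Real.log r := by
    intro C r hC hr n hn
    have : (n : ℝ) ≠ 0 := by positivity
    rw [Real.log_mul hC.ne' (by positivity), Real.log_pow]
    field_simp
  have fpos : ∀ n, 0 < f n := by
    obtain ⟨C, hC, h⟩ := hl (ρ / 2) (by positivity) (by linarith)
    exact fun n => lt_of_lt_of_le (by positivity) (h n)
  rw [tendsto_order]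
  constructor
  · intro l hlt
    obtain ⟨m, hm1, hm2⟩ := exists_between hlt
    have hm : Real.exp m < ρ := by rwa [← Real.lt_log_iff_exp_lt hρ]
    obtain ⟨C, hC, h⟩ := hl (Real.exp m) (Real.exp_pos m) hm
    have t := (aux (Real.log C) m).eventually (lt_mem_nhds hm1)
    filter_upwards [t, eventually_gt_atTop 0] with n hn hn0
    refine hn.trans_le ?_
    have e := ex C (Real.exp m) hC (Real.exp_pos m) n hn0
    rw [Real.log_exp] at e
    rw [← e]
    have := Real.log_le_log (by positivity) (h n)
    gcongr
  · intro l hlt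
    obtain ⟨m, hm1, hm2⟩ := exists_between hlt
    have hm : ρ < Real.exp m := by rwa [← Real.log_lt_iff_lt_exp hρ]
    obtain ⟨C, hC, h⟩ := hu (Real.exp m) hm
    have t := (aux (Real.log C) m).eventually (gt_mem_nhds hm2)
    filter_upwards [t, eventually_gt_atTop 0] with n hn hn0
    refine lt_of_le_of_lt ?_ hn
    have e := ex C (Real.exp m) hC (Real.exp_pos m) n hn0
    rw [Real.log_exp] at e
    rw [← e]
    have := Real.log_le_log (fpos n) (h n)
    gcongr

lemma lt_of_add_inv_lt (x z : ℝ) (hx : 1 < x) (hz : 1 < z) (h : x + x⁻¹ < z + z⁻¹) : x < z := by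
  by_contra hc
  push Not at hc
  have hx0 : 0 < x := by linarith
  have hz0 : 0 < z := by linarith
  have e : x + x⁻¹ - (z + z⁻¹) = (x - z) * (x * z - 1) / (x * z) := by field_simp; ring
  have : 0 ≤ (x - z) * (x * z - 1) / (x * z) := by
    apply div_nonneg _ (by positivity)
    apply mul_nonneg (by linarith)
    nlinarith
  linarith

/-- The limit `ψ^P(a,y) = lim (1/n) log C_n(a,y)` exists and equals
`max {λ^P(y), κ^P(a)}`. -/
theorem psiP_exists (a y : ℝ) (ha : 0 < a) (hy : 0 < y) :
    Tendsto (fun n : ℕ => Real.log (Cpf n a y) / n) atTop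
      (nhds (max
        (if y ≤ 1 then Real.log 2 else Real.log (y ^ 2 + 1) - Real.log y)
        (if a ≤ 2 then Real.log 2 else Real.log a - (1/2) * Real.log (a - 1)))) := by
  set α : ℝ := if y ≤ 1 then 2 else y + y⁻¹ with hα
  set β : ℝ := if a ≤ 2 then 2 else Real.sqrt (a - 1) + (Real.sqrt (a - 1))⁻¹ with hβ
  have hα0 : 0 < α := by rw [hα]; split_ifs <;> positivity
  have hβ0 : 0 < β := by
    rw [hβ]
    split_ifs with h
    · norm_num
    · have : 0 < Real.sqrt (a - 1) := Real.sqrt_pos.2 (by linarith)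
      positivity
  have two_le : ∀ x : ℝ, 0 < x → 2 ≤ x + x⁻¹ := by
    intro x hx
    have : x + x⁻¹ - 2 = (x - 1) ^ 2 / x := by field_simp; ring
    have : 0 ≤ (x - 1) ^ 2 / x := by positivity
    linarith
  have e1 : (if y ≤ 1 then Real.log 2 else Real.log (y ^ 2 + 1) - Real.log y) = Real.log α := by
    rw [hα]
    split_ifs with h
    · rfl
    · rw [← Real.log_div (by positivity) hy.ne']
      congr 1
      field_simp
  have e2 : (if a ≤ 2 then Real.log 2 else Real.log a - (1/2) * Real.log (a - 1))
      = Real.log β := by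
    rw [hβ]
    split_ifs with h
    · rfl
    · have h1 : 0 < a - 1 := by linarith
      have hs : 0 < Real.sqrt (a - 1) := Real.sqrt_pos.2 h1
      have hsq : Real.sqrt (a - 1) ^ 2 = a - 1 := Real.sq_sqrt h1.le
      have : Real.sqrt (a - 1) + (Real.sqrt (a - 1))⁻¹ = a / Real.sqrt (a - 1) := by
        field_simp
        rw [hsq]; ring
      rw [this, Real.log_div ha.ne' hs.ne', Real.log_sqrt h1.le]
      ring
  have e3 : max (Real.log α) (Real.log β) = Real.log (max α β) := by
    rcases le_total α β with h | h
    · rw [max_eq_right h, max_eq_right (Real.log_le_log hα0 h)]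
    · rw [max_eq_left h, max_eq_left (Real.log_le_log hβ0 h)]
  rw [e1, e2, e3]
  simp only [Cpf_eq_Wpf]
  apply tendsto_of_bounds _ _ (lt_max_of_lt_left hα0)
  · intro r hr hrm
    by_cases hr2 : r < 2
    · exact lower_two a y r ha hy hr hr2
    push Not at hr2
    rcases lt_max_iff.1 hrm with h | h
    · rw [hα] at h
      split_ifs at h with hy1
      · linarith
      · obtain ⟨C, hC, hb⟩ := lower_y a y ha (by linarith)
        refine ⟨C, hC, fun n => le_trans ?_ (hb n)⟩
        gcongr
    · rw [hβ] at h
      split_ifs at h with ha2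
      · linarith
      · refine lower_a a y (Real.sqrt (a - 1)) r hy ?_ ?_ hr2 h
        · rw [Real.lt_sqrt (by norm_num)]; linarith
        · rw [Real.sq_sqrt (by linarith)]; ring
  · intro R hR
    obtain ⟨h1, h2⟩ := max_lt_iff.1 hR
    have hR2 : 2 < R := by
      refine lt_of_le_of_lt ?_ h1
      rw [hα]
      split_ifs
      · exact le_rfl
      · exact two_le y hy
    set D : ℝ := Real.sqrt (R ^ 2 - 4) with hD
    have hD0 : 0 < D := Real.sqrt_pos.2 (by nlinarith)
    have hD2 : D ^ 2 = R ^ 2 - 4 := Real.sq_sqrt (by nlinarith)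
    obtain ⟨z, hz1, hz⟩ : ∃ z : ℝ, 1 < z ∧ z + z⁻¹ = R := by
      refine ⟨(R + D) / 2, by linarith, ?_⟩
      have : (R + D) ≠ 0 := by positivity
      field_simp
      nlinarith
    rw [← hz] at h1 h2 ⊢
    apply upper_z a y z ha hy (by linarith)
    · rw [hα] at h1
      split_ifs at h1 with hy1
      · linarith
      · exact (lt_of_add_inv_lt y z (by linarith) hz1 h1).le
    · rw [hβ] at h2
      split_ifs at h2 with ha2
      · nlinarith
      · have hs1 : 1 < Real.sqrt (a - 1) := by
          rw [Real.lt_sqrt (by norm_num)]; linarith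
        have := lt_of_add_inv_lt _ z hs1 hz1 h2
        have hsq : Real.sqrt (a - 1) ^ 2 = a - 1 := Real.sq_sqrt (by linarith)
        nlinarith
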